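/- arXiv:2212.06416 — 5 statements merged into one kernel-verified Lean document; each statement's English description precedes it below -/
import Mathlib

section
/- Let E be a real inner product space, let θ⁰, θ* ∈ E, let η ∈ ℝ with η ≠ 0, let y* ∈ ℝ, and let g : ℝ → ℝ be a loss function (of the model output, with label y* fixed). Suppose x* ∈ E and ζ ∈ ℝ satisfy: g has derivative ζ at ⟪θ⁰, x*⟫, ζ ≠ 0, and x* = (−1/(η · ζ)) • (θ* − θ⁰). Then the one-step gradient-descent update from θ⁰ on the single example x*, namely θ⁰ − η • ∇(θ ↦ g(⟪θ, x*⟫))(θ⁰), equals θ*; i.e., the function θ ↦ g(⟪θ, x*⟫) has gradient ζ • x* at θ⁰ and θ⁰ − η • (ζ • x*) = θ*. -/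
open RealInnerProductSpace

/-- Chain rule for a scalar function of the linear form `θ ↦ ⟪θ, x⟫`. -/
theorem HasDerivAt.hasGradientAt_comp_inner_right
    {E : Type*} [NormedAddCommGroup E] [InnerProductSpace ℝ E] [CompleteSpace E]
    {g : ℝ → ℝ} {ζ : ℝ} {θ x : E} (hg : HasDerivAt g ζ ⟪θ, x⟫) :
    HasGradientAt (fun θ : E => g ⟪θ, x⟫) (ζ • x) θ := by
  rw [hasGradientAt_iff_hasFDerivAt, map_smul]
  simp_rw [real_inner_comm x] at hg ⊢
  exact hg.comp_hasFDerivAt θ (innerSL ℝ x).hasFDerivAt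

/-- Theorem 1 (one-shot teachability): if the loss `g` has derivative `ζ ≠ 0` at `⟪θ⁰, x*⟫`
and `x* = (−1/(ηζ)) • (θ* − θ⁰)`, then `θ ↦ g ⟪θ, x*⟫` has gradient `ζ • x*` at `θ⁰` and the
one-step gradient-descent update `θ⁰ − η • (ζ • x*)` equals `θ*`. -/
theorem one_shot_teachability
    {E : Type*} [NormedAddCommGroup E] [InnerProductSpace ℝ E] [CompleteSpace E]
    (θ0 θstar : E) (η : ℝ) (hη : η ≠ 0) (ystar : ℝ) (g : ℝ → ℝ)
    (xstar : E) (ζ : ℝ)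
    (hg : HasDerivAt g ζ ⟪θ0, xstar⟫) (hζ : ζ ≠ 0)
    (hx : xstar = (-1 / (η * ζ)) • (θstar - θ0)) :
    HasGradientAt (fun θ : E => g ⟪θ, xstar⟫) (ζ • xstar) θ0 ∧
      θ0 - η • (ζ • xstar) = θstar := by
  refine ⟨hg.hasGradientAt_comp_inner_right, ?_⟩
  have hcoef : η * ζ * (-1 / (η * ζ)) = -1 := by field_simp
  rw [hx, smul_smul, smul_smul, hcoef, neg_one_smul, sub_neg_eq_add, add_sub_cancel]
end

section
/- Let E be a real inner product space, let θ⁰, θ* ∈ E, and let η ∈ ℝ with η ≠ 0. Then there exist x ∈ E and y ∈ ℝ such that the one-step gradient-descent update under square loss, θ⁰ − η • (2 · (⟪θ⁰, x⟫ − y)) • x, equals θ*. (Explicitly, one may take x = (1/(2 · η · c)) • (θ* − θ⁰) for any c ≠ 0 and y = c + ⟪θ⁰, x⟫.) -/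
open RealInnerProductSpace

/-- One-shot teachability of the square-loss learner with arbitrary initial parameter `θ⁰`:
there is a single teaching example `(x, y)` whose one-step square-loss gradient-descent update
takes `θ⁰` to `θ*`. -/
theorem squareLoss_one_shot_exists
    {E : Type*} [NormedAddCommGroup E] [InnerProductSpace ℝ E]
    (θ0 θstar : E) (η : ℝ) (hη : η ≠ 0) :
    ∃ (x : E) (y : ℝ), θ0 - η • ((2 * (⟪θ0, x⟫ - y)) • x) = θstar := by
  refine ⟨(2 * η)⁻¹ • (θstar - θ0), 1 + ⟪θ0, (2 * η)⁻¹ • (θstar - θ0)⟫, ?_⟩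
  rw [sub_add_cancel_right, smul_smul, smul_smul,
    show η * (2 * -1) * (2 * η)⁻¹ = -1 by field_simp, neg_one_smul, sub_neg_eq_add,
    add_sub_cancel]
end

section
/- Let E be a real inner product space, let x ∈ E, and let η, y ∈ ℝ. If 2 · η · ‖x‖² ≠ 1, then the one-step gradient-descent map under square loss on the fixed example (x, y), namely T(θ) = θ − η • (2 · (⟪θ, x⟫ − y)) • x, is a bijection of E onto itself; in particular it is surjective. -/
open RealInnerProductSpace

/-- Lemma 1(a) for the square-loss learner: if `2η‖x‖² ≠ 1`, the one-step square-loss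
gradient-descent map `θ ↦ θ − η • (2(⟪θ, x⟫ − y)) • x` is a bijection of `E` (in particular
surjective). -/
theorem squareLoss_update_bijective
    {E : Type*} [NormedAddCommGroup E] [InnerProductSpace ℝ E]
    (x : E) (η y : ℝ) (h : 2 * η * ‖x‖ ^ 2 ≠ 1) :
    Function.Bijective (fun θ : E => θ - η • ((2 * (⟪θ, x⟫ - y)) • x)) := by
  have hc : 1 - 2 * η * ‖x‖ ^ 2 ≠ 0 := sub_ne_zero.mpr h.symm
  -- The residual `⟪θ, x⟫ - y` is scaled by `1 - 2η‖x‖²`, which gives the inverse map.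
  refine Function.bijective_iff_has_inverse.mpr
    ⟨fun w => w + (2 * η * ((⟪w, x⟫ - y) / (1 - 2 * η * ‖x‖ ^ 2))) • x, fun θ => ?_, fun w => ?_⟩
  · have key : (⟪θ - η • ((2 * (⟪θ, x⟫ - y)) • x), x⟫ - y) / (1 - 2 * η * ‖x‖ ^ 2)
        = ⟪θ, x⟫ - y := by
      rw [div_eq_iff hc, inner_sub_left, real_inner_smul_left, real_inner_smul_left,
        real_inner_self_eq_norm_sq]
      ring
    simp only [key]
    module
  · have key : ⟪w + (2 * η * ((⟪w, x⟫ - y) / (1 - 2 * η * ‖x‖ ^ 2))) • x, x⟫ - y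
        = (⟪w, x⟫ - y) / (1 - 2 * η * ‖x‖ ^ 2) := by
      rw [inner_add_left, real_inner_smul_left, real_inner_self_eq_norm_sq, eq_div_iff hc]
      field_simp
      ring
    simp only [key]
    module
end

section
/- Let E be a real inner product space, let x ∈ E, and let η, y ∈ ℝ. Then the one-step gradient-descent map under logistic loss on the fixed example (x, y), namely T(θ) = θ − η • ((−y / (1 + exp(y · ⟪θ, x⟫))) • x), is surjective from E onto E. -/
open RealInnerProductSpace

/-- Moving a point along a fixed direction `x` by a continuous bounded function of its inner
product with `x` is a surjective operation. -/
theorem surjective_add_smul_of_continuous_of_bounded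
    {E : Type*} [NormedAddCommGroup E] [InnerProductSpace ℝ E]
    (x : E) {g : ℝ → ℝ} (hg : Continuous g) {C : ℝ} (hC : ∀ s, |g s| ≤ C) :
    Function.Surjective (fun θ : E => θ + g ⟪θ, x⟫ • x) := by
  intro w
  have hcont : Continuous fun t : ℝ => t + g ⟪w + t • x, x⟫ := by fun_prop
  have hC0 : 0 ≤ C := (abs_nonneg _).trans (hC 0)
  obtain ⟨t, -, ht⟩ := intermediate_value_Icc (neg_le_self hC0) hcont.continuousOn
    (show (0 : ℝ) ∈ Set.Icc _ _ from
      ⟨by linarith [(abs_le.mp (hC ⟪w + (-C) • x, x⟫)).2],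
        by linarith [(abs_le.mp (hC ⟪w + C • x, x⟫)).1]⟩)
  refine ⟨w + t • x, ?_⟩
  simp only at ht ⊢
  rw [add_assoc, ← add_smul, ht, zero_smul, add_zero]

/-- Lemma 1(a) for the logistic-loss learner: the one-step logistic-loss gradient-descent map
`θ ↦ θ − η • ((−y/(1 + exp(y⟪θ, x⟫))) • x)` is surjective from `E` onto `E`. -/
theorem logisticLoss_update_surjective
    {E : Type*} [NormedAddCommGroup E] [InnerProductSpace ℝ E]
    (x : E) (η y : ℝ) :
    Function.Surjective
      (fun θ : E => θ - η • ((-y / (1 + Real.exp (y * ⟪θ, x⟫))) • x)) := by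
  have hpos (s : ℝ) : 0 < 1 + Real.exp (y * s) := by positivity
  have hg : Continuous fun s : ℝ => η * y / (1 + Real.exp (y * s)) :=
    continuous_const.div (by fun_prop) fun s => (hpos s).ne'
  have hC (s : ℝ) : |η * y / (1 + Real.exp (y * s))| ≤ |η * y| := by
    rw [abs_div, abs_of_pos (hpos s)]
    exact div_le_self (abs_nonneg _) (by linarith [Real.exp_pos (y * s)])
  convert surjective_add_smul_of_continuous_of_bounded x hg hC using 2 with θ
  rw [smul_smul, sub_eq_add_neg, ← neg_smul]
  congr 2
  ring
end

section
/- Let E be a real inner product space, let x ∈ E, let y ∈ ℝ, and let η ∈ ℝ with η > 0. Define the one-step hinge-loss gradient-descent map T : E → E by T(θ) = θ + (η · y) • x if 1 − y · ⟪θ, x⟫ > 0, and T(θ) = θ otherwise. Then T is surjective from E onto E. -/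
open RealInnerProductSpace

/-- Lemma 1(a) for the hinge-loss learner: the one-step hinge-loss gradient-descent map,
`T θ = θ + (ηy) • x` when the example is active at `θ` (`1 − y⟪θ, x⟫ > 0`) and `T θ = θ`
otherwise, is surjective from `E` onto `E`. -/
theorem hingeLoss_update_surjective
    {E : Type*} [NormedAddCommGroup E] [InnerProductSpace ℝ E]
    (x : E) (y η : ℝ) (hη : η > 0) :
    Function.Surjective
      (fun θ : E => if 1 - y * ⟪θ, x⟫ > 0 then θ + (η * y) • x else θ) := by
  intro φ
  by_cases hφ : 1 - y * ⟪φ, x⟫ > 0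
  · refine ⟨φ - (η * y) • x, ?_⟩
    have h_active : 1 - y * ⟪φ - (η * y) • x, x⟫ > 0 := by
      rw [inner_sub_left, real_inner_smul_left]
      have h_nonneg : 0 ≤ η * (y ^ 2 * ⟪x, x⟫) :=
        mul_nonneg hη.le (mul_nonneg (sq_nonneg y) real_inner_self_nonneg)
      linarith
    simp only [if_pos h_active, sub_add_cancel]
  · exact ⟨φ, if_neg hφ⟩
end
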